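/- arXiv:1812.08763 — 4 statements merged into one kernel-verified Lean document; each statement's English description precedes it below -/
import Mathlib

section
/- Let U be a splitting set of an objective program Π. A propositional interpretation I ⊆ At is a stable model of Π if and only if there is a solution ⟨I_b, I_t⟩ of Π with respect to U such that I = I_b ∪ I_t. -/
open scoped Classical

variable {At : Type}

/-! ### Objective literals, rules and programs -/

/-- Objective literals: truth constants, an atom `a`, `not a`, or `not not a`. -/
inductive OLit (At : Type) : Type
  | top : OLit At
  | bot : OLit At
  | pos (a : At) : OLit At
  | neg (a : At) : OLit At
  | nneg (a : At) : OLit At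

namespace OLit

/-- Classical satisfaction of an objective literal by an interpretation `I`
(`not` is read as classical negation). -/
def sat (I : Set At) : OLit At → Prop
  | .top => True
  | .bot => False
  | .pos a => a ∈ I
  | .neg a => a ∉ I
  | .nneg a => a ∈ I

/-- Atoms occurring in an objective literal. -/
def atoms : OLit At → Set At
  | .top => ∅
  | .bot => ∅
  | .pos a => {a}
  | .neg a => {a}
  | .nneg a => {a}

/-- The reduct of a literal w.r.t. `I`: every negated part is replaced by its
truth value w.r.t. `I`. -/
noncomputable def reduct (I : Set At) : OLit At → OLit At
  | .top => .top
  | .bot => .bot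
  | .pos a => .pos a
  | .neg a => if a ∈ I then .bot else .top
  | .nneg a => if a ∈ I then .top else .bot

/-- Replace every atom belonging to `U` by `⊤` if it is in `I` and by `⊥` otherwise. -/
noncomputable def esimp (U I : Set At) : OLit At → OLit At
  | .top => .top
  | .bot => .bot
  | .pos a => if a ∈ U then (if a ∈ I then .top else .bot) else .pos a
  | .neg a => if a ∈ U then (if a ∈ I then .bot else .top) else .neg a
  | .nneg a => if a ∈ U then (if a ∈ I then .top else .bot) else .nneg a

/-- Default negation `not l` of an objective literal. -/
def negate : OLit At → OLit At
  | .top => .bot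
  | .bot => .top
  | .pos a => .neg a
  | .neg a => .nneg a
  | .nneg a => .neg a

end OLit

/-- An objective rule `a₁ ∨ … ∨ aₙ ← L₁, …, Lₘ`. -/
structure ORule (At : Type) : Type where
  head : List At
  body : List (OLit At)

namespace ORule

/-- Classical satisfaction of a rule. -/
def sat (I : Set At) (r : ORule At) : Prop :=
  (∀ L ∈ r.body, L.sat I) → ∃ a ∈ r.head, a ∈ I

/-- The head atoms of a rule, as a set. -/
def headAtoms (r : ORule At) : Set At := {a | a ∈ r.head}

/-- All atoms occurring in a rule. -/
def atoms (r : ORule At) : Set At := r.headAtoms ∪ ⋃ L ∈ r.body, L.atoms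

/-- Reduct of a rule w.r.t. `I`. -/
noncomputable def reduct (I : Set At) (r : ORule At) : ORule At :=
  ⟨r.head, r.body.map (OLit.reduct I)⟩

/-- Replace in the body every atom of `U` by its truth value w.r.t. `I`. -/
noncomputable def esimp (U I : Set At) (r : ORule At) : ORule At :=
  ⟨r.head, r.body.map (OLit.esimp U I)⟩

end ORule

/-- `I` is a classical model of the objective program `P`. -/
def isOModel (I : Set At) (P : Set (ORule At)) : Prop := ∀ r ∈ P, r.sat I

/-- The reduct `P^I` of an objective program. -/
noncomputable def oReduct (P : Set (ORule At)) (I : Set At) : Set (ORule At) :=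
  (ORule.reduct I) '' P

/-- `I` is a stable model of `P`: a ⊆-minimal classical model of `P^I`. -/
def isStable (I : Set At) (P : Set (ORule At)) : Prop :=
  isOModel I (oReduct P I) ∧ ∀ J : Set At, J ⊆ I → isOModel J (oReduct P I) → J = I

/-- `SM[P]`, the set of stable models of `P`. -/
def SMs (P : Set (ORule At)) : Set (Set At) := {I | isStable I P}

/-- `U` is a splitting set of the objective program `P`. -/
def isSplittingSet (U : Set At) (P : Set (ORule At)) : Prop :=
  ∀ r ∈ P, r.atoms ⊆ U ∨ r.headAtoms ∩ U = ∅

/-- The bottom `b_U(P)`. -/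
def oBottom (U : Set At) (P : Set (ORule At)) : Set (ORule At) := {r ∈ P | r.atoms ⊆ U}

/-- The top `t_U(P)`. -/
def oTop (U : Set At) (P : Set (ORule At)) : Set (ORule At) := P \ oBottom U P

/-- Simplify a (top) program by replacing every atom of `U` by its truth value w.r.t. `I`. -/
noncomputable def simpProg (U I : Set At) (T : Set (ORule At)) : Set (ORule At) :=
  (ORule.esimp U I) '' T

/-- `e_U(P, I)`. -/
noncomputable def eU (U : Set At) (P : Set (ORule At)) (I : Set At) : Set (ORule At) :=
  simpProg U I (oTop U P)

/-- `⟨Ib, It⟩` is a solution of `P` w.r.t. `U`. -/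
def isSolution (U : Set At) (P : Set (ORule At)) (Ib It : Set At) : Prop :=
  isStable Ib (oBottom U P) ∧ isStable It (eU U P Ib)

/-- `⟨B, T⟩` is an arbitrary splitting of `P` w.r.t. the splitting set `U`. -/
def isArbSplitting (U : Set At) (P B T : Set (ORule At)) : Prop :=
  B ∩ T = ∅ ∧ B ∪ T = P ∧ (∀ r ∈ B, r.atoms ⊆ U) ∧ (∀ r ∈ T, r.headAtoms ∩ U = ∅)

/-! ### Epistemic specifications -/

/-- Subjective literals `K l`, `M l`, `not K l`, `not M l`. -/
inductive SLit (At : Type) : Type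
  | k (l : OLit At) : SLit At
  | m (l : OLit At) : SLit At
  | notk (l : OLit At) : SLit At
  | notm (l : OLit At) : SLit At

namespace SLit

/-- Satisfaction `W ⊨ L` of a subjective literal by a set of interpretations. -/
def sat (W : Set (Set At)) : SLit At → Prop
  | .k l => ∀ I ∈ W, l.sat I
  | .m l => ∃ I ∈ W, l.sat I
  | .notk l => ¬ ∀ I ∈ W, l.sat I
  | .notm l => ¬ ∃ I ∈ W, l.sat I

/-- Atoms occurring in a subjective literal. -/
def atoms : SLit At → Set At
  | .k l => l.atoms
  | .m l => l.atoms
  | .notk l => l.atoms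
  | .notm l => l.atoms

end SLit

/-- A body literal of an epistemic rule: objective or subjective. -/
inductive ELit (At : Type) : Type
  | obj (l : OLit At) : ELit At
  | sub (L : SLit At) : ELit At

namespace ELit

/-- Atoms occurring in a body literal. -/
def atoms : ELit At → Set At
  | .obj l => l.atoms
  | .sub L => L.atoms

/-- Atoms occurring in a body literal, if it is objective. -/
def objAtoms : ELit At → Set At
  | .obj l => l.atoms
  | .sub _ => ∅

/-- Atoms occurring in a body literal, if it is subjective. -/
def subAtoms : ELit At → Set At
  | .obj _ => ∅
  | .sub L => L.atoms

/-- The body literal is objective. -/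
def isObj : ELit At → Prop
  | .obj _ => True
  | .sub _ => False

/-- Subjective reduct of a body literal w.r.t. `W` and signature `U`. -/
noncomputable def sReduct (W : Set (Set At)) (U : Set At) : ELit At → ELit At
  | .obj l => .obj l
  | .sub L => if L.atoms ⊆ U then (if L.sat W then .obj .top else .obj .bot) else .sub L

/-- Subjective reduct of a body literal w.r.t. `W` for the full signature:
every subjective literal is replaced by its truth value, so the result is objective. -/
noncomputable def fullReduct (W : Set (Set At)) : ELit At → OLit At
  | .obj l => l
  | .sub L => if L.sat W then .top else .bot

end ELit

/-- An epistemic rule `a₁ ∨ … ∨ aₙ ← L₁, …, Lₘ`. -/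
structure ERule (At : Type) : Type where
  head : List At
  body : List (ELit At)

namespace ERule

/-- Head atoms of an epistemic rule. -/
def headAtoms (r : ERule At) : Set At := {a | a ∈ r.head}

/-- All atoms of an epistemic rule. -/
def atoms (r : ERule At) : Set At := r.headAtoms ∪ ⋃ L ∈ r.body, L.atoms

/-- Atoms occurring in objective body literals (`Atoms(Body_obj(r))`). -/
def bodyObjAtoms (r : ERule At) : Set At := ⋃ L ∈ r.body, L.objAtoms

/-- Atoms occurring in subjective body literals (`Atoms(Body_sub(r))`). -/
def bodySubAtoms (r : ERule At) : Set At := ⋃ L ∈ r.body, L.subAtoms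

/-- The rule is objective: no subjective literal occurs in it. -/
def isObjective (r : ERule At) : Prop := ∀ L ∈ r.body, L.isObj

/-- The rule is a subjective constraint: empty head and only subjective body literals. -/
def isSubjConstraint (r : ERule At) : Prop := r.head = [] ∧ ∀ L ∈ r.body, ¬ L.isObj

/-- Subjective reduct `r^W_U` of an epistemic rule. -/
noncomputable def sReduct (W : Set (Set At)) (U : Set At) (r : ERule At) : ERule At :=
  ⟨r.head, r.body.map (ELit.sReduct W U)⟩

/-- Subjective reduct `r^W` for the full signature, as an objective rule. -/
noncomputable def fullReduct (W : Set (Set At)) (r : ERule At) : ORule At :=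
  ⟨r.head, r.body.map (ELit.fullReduct W)⟩

end ERule

/-- Subjective reduct `P^W_U` of an epistemic program. -/
noncomputable def esReduct (P : Set (ERule At)) (W : Set (Set At)) (U : Set At) :
    Set (ERule At) :=
  (ERule.sReduct W U) '' P

/-- Subjective reduct `P^W` (full signature), as an objective program. -/
noncomputable def eFullReduct (P : Set (ERule At)) (W : Set (Set At)) : Set (ORule At) :=
  (ERule.fullReduct W) '' P

/-- Projection `W|_V` of a set of interpretations to the atoms in `V`. -/
def proj (W : Set (Set At)) (V : Set At) : Set (Set At) := (fun I => I ∩ V) '' W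

/-- `U` is an epistemic splitting set of `P`. -/
def isEpiSplittingSet (U : Set At) (P : Set (ERule At)) : Prop :=
  ∀ r ∈ P, r.atoms ⊆ U ∨ (r.bodyObjAtoms ∪ r.headAtoms) ∩ U = ∅

/-- `⟨B, T⟩` is a splitting of `P` w.r.t. the epistemic splitting set `U`. -/
def isEpiSplitting (U : Set At) (P B T : Set (ERule At)) : Prop :=
  B ∩ T = ∅ ∧ B ∪ T = P ∧ (∀ r ∈ B, r.atoms ⊆ U) ∧
    (∀ r ∈ T, (r.bodyObjAtoms ∪ r.headAtoms) ∩ U = ∅)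

/-- `W_b ⊔ W_t = { Ib ∪ It : Ib ∈ W_b, It ∈ W_t }`. -/
def squnion (Wb Wt : Set (Set At)) : Set (Set At) :=
  {I | ∃ Ib ∈ Wb, ∃ It ∈ Wt, I = Ib ∪ It}

/-- G91-world view: a nonempty `W` with `W = SM[P^W]`. -/
def isG91WorldView (W : Set (Set At)) (P : Set (ERule At)) : Prop :=
  W.Nonempty ∧ W = SMs (eFullReduct P W)

/-! ### Abstract semantics and its properties -/

/-- A semantics assigns to every epistemic program a collection of world views. -/
abbrev Semantics (At : Type) : Type := Set (ERule At) → Set (Set (Set At))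

/-- The objective program corresponding to an epistemic program without
subjective literals (the subjective reduct is independent of the world view there). -/
noncomputable def toObjProg (P : Set (ERule At)) : Set (ORule At) := eFullReduct P ∅

/-- Supra-ASP: on objective programs, either the unique world view is the nonempty
set of stable models, or there are no stable models and no world view. -/
def SupraASP (S : Semantics At) : Prop :=
  ∀ P : Set (ERule At), (∀ r ∈ P, r.isObjective) →
    ((SMs (toObjProg P) ≠ ∅ ∧ S P = {SMs (toObjProg P)}) ∨
     (SMs (toObjProg P) = ∅ ∧ S P = ∅))

/-- The epistemic splitting property for a semantics `S`. -/
def EpistemicSplittingProp (S : Semantics At) : Prop :=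
  ∀ (U : Set At) (P B T : Set (ERule At)), isEpiSplitting U P B T →
    ∀ W : Set (Set At),
      W ∈ S P ↔ ∃ Wb ∈ S B, ∃ Wt ∈ S (esReduct T Wb U), W = squnion Wb Wt

/-- Modal dependence relation `dep(a, b)`. -/
def dep (P : Set (ERule At)) (a b : At) : Prop :=
  ∃ r ∈ P, a ∈ r.headAtoms ∪ r.bodyObjAtoms ∧ b ∈ r.bodySubAtoms

/-- `P` is epistemically stratified. -/
def EpistemicallyStratified (P : Set (ERule At)) : Prop :=
  ∃ lam : At → ℕ,
    (∀ r ∈ P, ∀ a ∈ r.atoms \ r.bodySubAtoms, ∀ b ∈ r.atoms \ r.bodySubAtoms,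
        lam a = lam b) ∧
    (∀ a b : At, dep P a b → lam b < lam a)

/-- `W ⊨ r` for a subjective constraint `r`: some subjective body literal fails in `W`. -/
def wvSatConstraint (W : Set (Set At)) (r : ERule At) : Prop :=
  ∃ L ∈ r.body, ∃ s : SLit At, L = ELit.sub s ∧ ¬ s.sat W

/-- Subjective constraint monotonicity for a semantics `S`. -/
def SubjConstraintMonotonicity (S : Semantics At) : Prop :=
  ∀ (P : Set (ERule At)) (r : ERule At), r.isSubjConstraint →
    ∀ W : Set (Set At), W.Nonempty →
      (W ∈ S (P ∪ {r}) ↔ W ∈ S P ∧ wvSatConstraint W r)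

/-! ### The G11 semantics -/

/-- G11-reduct of a body literal: `K l` is replaced by `l` when `W ⊨ K l` and by `⊥`
otherwise; the remaining subjective literals are replaced by their truth value. -/
noncomputable def ELit.g11Reduct (W : Set (Set At)) : ELit At → OLit At
  | .obj l => l
  | .sub (.k l) => if (SLit.k l).sat W then l else OLit.bot
  | .sub (.notk l) => if (SLit.notk l).sat W then OLit.top else OLit.bot
  | .sub (.m l) => if (SLit.m l).sat W then OLit.top else OLit.bot
  | .sub (.notm l) => if (SLit.notm l).sat W then OLit.top else OLit.bot

/-- G11-reduct of a program. -/
noncomputable def g11Reduct (P : Set (ERule At)) (W : Set (Set At)) : Set (ORule At) :=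
  (fun r : ERule At => (⟨r.head, r.body.map (ELit.g11Reduct W)⟩ : ORule At)) '' P

/-- G11-world view. -/
def isG11WorldView (W : Set (Set At)) (P : Set (ERule At)) : Prop :=
  W.Nonempty ∧ W = SMs (g11Reduct P W)

/-! ### The K15 and S17 semantics -/

/-- K15-reduct of a body literal: occurrences of `K l` with `W ⊭ K l` become `⊥`,
all other occurrences of `K l` are replaced by `l` (so `not K l` becomes `not l`
when `W ⊨ K l` and `⊤` otherwise; `M l` is treated as `not K not l`). -/
noncomputable def ELit.k15Reduct (W : Set (Set At)) : ELit At → OLit At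
  | .obj l => l
  | .sub (.k l) => if (SLit.k l).sat W then l else OLit.bot
  | .sub (.notk l) => if (SLit.k l).sat W then l.negate else OLit.top
  | .sub (.m l) => if (SLit.k l.negate).sat W then l.negate.negate else OLit.top
  | .sub (.notm l) => if (SLit.k l.negate).sat W then l.negate else OLit.bot

/-- K15-reduct of a program. -/
noncomputable def k15Reduct (P : Set (ERule At)) (W : Set (Set At)) : Set (ORule At) :=
  (fun r : ERule At => (⟨r.head, r.body.map (ELit.k15Reduct W)⟩ : ORule At)) '' P

/-- K15-world view. -/
def isK15WorldView (W : Set (Set At)) (P : Set (ERule At)) : Prop :=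
  W.Nonempty ∧ W = SMs (k15Reduct P W)

/-- The objective literals `l` such that `K l` occurs in `P`. -/
def kLits (P : Set (ERule At)) : Set (OLit At) :=
  {l | ∃ r ∈ P, ∃ L ∈ r.body, L = ELit.sub (SLit.k l) ∨ L = ELit.sub (SLit.notk l)}

/-- `Φ_W`: the epistemic literals `not K l` of `E_P` satisfied by `W`. -/
def Phi (P : Set (ERule At)) (W : Set (Set At)) : Set (OLit At) :=
  {l ∈ kLits P | (SLit.notk l).sat W}

/-- S17-world view: a K15-world view maximizing the satisfied epistemic negations. -/
def isS17WorldView (W : Set (Set At)) (P : Set (ERule At)) : Prop :=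
  isK15WorldView W P ∧
    ¬ ∃ W' : Set (Set At), isK15WorldView W' P ∧ Phi P W ⊂ Phi P W'

/-! ### EHT and the F15 semantics -/

/-- EHT satisfaction of an objective literal at point `I` with "here" mapping `h`. -/
def OLit.ehtSat (h : Set At → Set At) (I : Set At) : OLit At → Prop
  | .top => True
  | .bot => False
  | .pos a => a ∈ h I
  | .neg a => a ∉ I
  | .nneg a => a ∈ I

/-- EHT satisfaction of a subjective literal. -/
def SLit.ehtSat (W : Set (Set At)) (h : Set At → Set At) : SLit At → Prop
  | .k l => ∀ I' ∈ W, l.ehtSat h I'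
  | .m l => ∃ I' ∈ W, l.ehtSat h I'
  | .notk l => ¬ ∀ I' ∈ W, l.ehtSat id I'
  | .notm l => ¬ ∃ I' ∈ W, l.ehtSat id I'

/-- EHT satisfaction of a body literal at point `I`. -/
def ELit.ehtSat (W : Set (Set At)) (h : Set At → Set At) (I : Set At) : ELit At → Prop
  | .obj l => l.ehtSat h I
  | .sub L => L.ehtSat W h

/-- EHT satisfaction of a rule at point `I`. -/
def ERule.ehtSat (W : Set (Set At)) (h : Set At → Set At) (I : Set At) (r : ERule At) : Prop :=
  (∀ L ∈ r.body, L.ehtSat W h I) → ∃ a ∈ r.head, a ∈ h I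

/-- `⟨W, h⟩` is an EHT-model of `P` (with `W` nonempty and `h T ⊆ T` on `W`). -/
def isEHTModel (W : Set (Set At)) (h : Set At → Set At) (P : Set (ERule At)) : Prop :=
  W.Nonempty ∧ (∀ T ∈ W, h T ⊆ T) ∧ ∀ I ∈ W, ∀ r ∈ P, r.ehtSat W h I

/-- `W` is an equilibrium EHT-model of `P`. -/
def isEquilibriumEHT (W : Set (Set At)) (P : Set (ERule At)) : Prop :=
  isEHTModel W id P ∧
    ¬ ∃ h : Set At → Set At, isEHTModel W h P ∧ ∃ I ∈ W, h I ⊂ I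

/-- The auxiliary relation `W, X ⊨* P`. -/
def satStar (W X : Set (Set At)) (P : Set (ERule At)) : Prop :=
  (∀ I ∈ X, ∀ r ∈ P, r.ehtSat W id I) ∧
  (∀ h : Set At → Set At, (∀ T ∈ W, h T ⊆ T) → (∀ T ∈ W \ X, h T = T) →
    (∃ I ∈ W, ∀ r ∈ P, r.ehtSat W h I) → ∀ T ∈ W, h T = T)

/-- The preference order `W ≤_P W'`. -/
def prefLE (P : Set (ERule At)) (W W' : Set (Set At)) : Prop :=
  ∀ I : Set At, (∃ V : Set (Set At), isEquilibriumEHT V P ∧ I ∈ V) →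
    (satStar (W ∪ {I}) W P → satStar (W' ∪ {I}) W' P)

/-- F15-world view: an equilibrium EHT-model maximal w.r.t. `⊂` and `<_P`. -/
def isF15WorldView (W : Set (Set At)) (P : Set (ERule At)) : Prop :=
  isEquilibriumEHT W P ∧
    ¬ ∃ W' : Set (Set At), isEquilibriumEHT W' P ∧
        (W ⊂ W' ∨ (prefLE P W W' ∧ ¬ prefLE P W' W))

/-- Satisfaction of the reduct of a literal with respect to `I` by `J`. -/
def OLit.htSat (J I : Set At) : OLit At → Prop
  | .top => True
  | .bot => False
  | .pos a => a ∈ J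
  | .neg a => a ∉ I
  | .nneg a => a ∈ I

/-- Satisfaction of the reduct of a rule with respect to `I` by `J`. -/
def ORule.htSat (J I : Set At) (r : ORule At) : Prop :=
  (∀ L ∈ r.body, L.htSat J I) → ∃ a ∈ r.head, a ∈ J

theorem OLit.sat_reduct (J I : Set At) (L : OLit At) :
    (L.reduct I).sat J ↔ L.htSat J I := by
  cases L <;> simp only [OLit.reduct, OLit.htSat] <;> (try split_ifs) <;> simp_all [OLit.sat]

theorem OLit.htSat_mono {J K I : Set At} (h : J ⊆ K) {L : OLit At} (hL : L.htSat J I) :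
    L.htSat K I := by
  cases L <;> simp_all [OLit.htSat]
  exact h hL

theorem OLit.htSat_congr {V J K I M : Set At} {L : OLit At} (hL : L.atoms ⊆ V)
    (hJK : J ∩ V = K ∩ V) (hIM : I ∩ V = M ∩ V) : L.htSat J I ↔ L.htSat K M := by
  cases L <;> simp_all [OLit.htSat, OLit.atoms, Set.ext_iff]

theorem OLit.htSat_esimp (U B J I : Set At) (L : OLit At) :
    (L.esimp U B).htSat J I ↔ L.htSat (J \ U ∪ B ∩ U) (I \ U ∪ B ∩ U) := by
  cases L <;> simp only [OLit.esimp] <;> (try split_ifs) <;> simp_all [OLit.htSat]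

theorem isOModel_oReduct {J I : Set At} {P : Set (ORule At)} :
    isOModel J (oReduct P I) ↔ ∀ r ∈ P, r.htSat J I := by
  simp [isOModel, oReduct, ORule.sat, ORule.reduct, ORule.htSat, OLit.sat_reduct]

theorem ORule.htSat_congr {V J K I M : Set At} {r : ORule At} (hr : r.atoms ⊆ V)
    (hJK : J ∩ V = K ∩ V) (hIM : I ∩ V = M ∩ V) : r.htSat J I ↔ r.htSat K M := by
  have hbody : ∀ L ∈ r.body, (L.htSat J I ↔ L.htSat K M) := fun L hL =>
    OLit.htSat_congr ((Set.subset_biUnion_of_mem (u := OLit.atoms) hL).trans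
      (Set.subset_union_right.trans hr)) hJK hIM
  have hhead : ∀ a ∈ r.head, (a ∈ J ↔ a ∈ K) := fun a ha => by
    have haV : a ∈ V := hr (Or.inl ha)
    have := Set.ext_iff.mp hJK a
    simpa [haV] using this
  unfold ORule.htSat
  rw [forall₂_congr hbody]
  exact imp_congr_right fun _ => exists_congr fun a => and_congr_right (hhead a)

theorem ORule.htSat_esimp {U B J I : Set At} {r : ORule At} (hr : r.headAtoms ∩ U = ∅) :
    (r.esimp U B).htSat J I ↔ r.htSat (J \ U ∪ B ∩ U) (I \ U ∪ B ∩ U) := by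
  have hhead : ∀ a ∈ r.head, (a ∈ J ↔ a ∈ J \ U ∪ B ∩ U) := fun a ha => by
    have haU : a ∉ U := fun h => Set.eq_empty_iff_forall_notMem.mp hr a ⟨ha, h⟩
    simp [haU]
  simp only [ORule.htSat, ORule.esimp, List.forall_mem_map, OLit.htSat_esimp]
  exact imp_congr_right fun _ => exists_congr fun a => and_congr_right (hhead a)

theorem ORule.htSat_of_total {U J I : Set At} {r : ORule At} (hr : r.headAtoms ∩ U = ∅)
    (hJI : J ⊆ I) (hIJ : I \ U ⊆ J) (h : r.htSat I I) : r.htSat J I := by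
  intro hbody
  obtain ⟨a, ha, haI⟩ := h fun L hL => OLit.htSat_mono hJI (hbody L hL)
  exact ⟨a, ha, hIJ ⟨haI, fun haU => Set.eq_empty_iff_forall_notMem.mp hr a ⟨ha, haU⟩⟩⟩

theorem isOModel_oBottom_congr {U J K I M : Set At} {P : Set (ORule At)}
    (hJK : J ∩ U = K ∩ U) (hIM : I ∩ U = M ∩ U) :
    isOModel J (oReduct (oBottom U P) I) ↔ isOModel K (oReduct (oBottom U P) M) := by
  simp only [isOModel_oReduct]
  exact forall₂_congr fun r hr => ORule.htSat_congr hr.2 hJK hIM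

theorem isSplittingSet.headAtoms_inter_eq_empty {U : Set At} {P : Set (ORule At)}
    (hU : isSplittingSet U P) {r : ORule At} (hr : r ∈ oTop U P) : r.headAtoms ∩ U = ∅ :=
  (hU r hr.1).resolve_left fun h => hr.2 ⟨hr.1, h⟩

theorem isSplittingSet.isOModel_eU {U : Set At} {P : Set (ORule At)}
    (hU : isSplittingSet U P) (B J I : Set At) :
    isOModel J (oReduct (eU U P B) I) ↔
      isOModel (J \ U ∪ B ∩ U) (oReduct (oTop U P) (I \ U ∪ B ∩ U)) := by
  simp only [isOModel_oReduct, eU, simpProg, Set.forall_mem_image]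
  exact forall₂_congr fun r hr => ORule.htSat_esimp (hU.headAtoms_inter_eq_empty hr)

theorem isOModel_oReduct_iff_oBottom_oTop (U : Set At) {P : Set (ORule At)} {J I : Set At} :
    isOModel J (oReduct P I) ↔
      isOModel J (oReduct (oBottom U P) I) ∧ isOModel J (oReduct (oTop U P) I) := by
  simp only [isOModel_oReduct]
  refine ⟨fun h => ⟨fun r hr => h r hr.1, fun r hr => h r hr.1⟩, fun h r hr => ?_⟩
  by_cases hb : r ∈ oBottom U P
  exacts [h.1 r hb, h.2 r ⟨hr, hb⟩]

theorem isStable.subset_of_oBottom {U B : Set At} {P : Set (ORule At)}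
    (h : isStable B (oBottom U P)) : B ⊆ U := by
  rw [← Set.inter_eq_left]
  exact h.2 _ Set.inter_subset_left
    ((isOModel_oBottom_congr (by simp [Set.inter_assoc]) rfl).mpr h.1)

theorem isSplittingSet.sdiff_eq_of_isStable_eU {U B T : Set At} {P : Set (ORule At)}
    (hU : isSplittingSet U P) (h : isStable T (eU U P B)) : T \ U = T := by
  refine h.2 _ Set.sdiff_subset ?_
  have := h.1
  rw [hU.isOModel_eU] at this ⊢
  rwa [Set.sdiff_sdiff, Set.union_self]

theorem isSplittingSet.isSolution_of_isStable {U I : Set At} {P : Set (ORule At)}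
    (hU : isSplittingSet U P) (h : isStable I P) : isSolution U P (I ∩ U) (I \ U) := by
  obtain ⟨hmodel, hmin⟩ := h
  obtain ⟨hbot, htop⟩ := (isOModel_oReduct_iff_oBottom_oTop U).mp hmodel
  have hcap : I ∩ U ∩ U = I ∩ U := by simp [Set.inter_assoc]
  have hI : (I \ U) \ U ∪ I ∩ U ∩ U = I := by
    rw [hcap, Set.sdiff_sdiff, Set.union_self, Set.sdiff_union_inter]
  refine ⟨⟨(isOModel_oBottom_congr hcap hcap).mpr hbot, fun J hJ hJmodel => ?_⟩,
    ⟨by rwa [hU.isOModel_eU, hI], fun J hJ hJmodel => ?_⟩⟩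
  · have hJU : J ⊆ U := hJ.trans Set.inter_subset_right
    have hJI : J ∪ I \ U ⊆ I := Set.union_subset (hJ.trans Set.inter_subset_left) Set.sdiff_subset
    have hcapJ : (J ∪ I \ U) ∩ U = J := by
      rw [Set.union_inter_distrib_right, Set.sdiff_inter_self, Set.union_empty,
        Set.inter_eq_left.mpr hJU]
    have heq := hmin _ hJI <| (isOModel_oReduct_iff_oBottom_oTop U).mpr
      ⟨(isOModel_oBottom_congr (by rw [hcapJ, Set.inter_eq_left.mpr hJU]) hcap.symm).mpr hJmodel,
        isOModel_oReduct.mpr fun r hr => ORule.htSat_of_total (hU.headAtoms_inter_eq_empty hr)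
          hJI Set.subset_union_right (isOModel_oReduct.mp htop r hr)⟩
    rw [← hcapJ, heq]
  · have hJU : J \ U = J := by
      rw [sdiff_eq_left]
      exact Set.disjoint_sdiff_left.mono_left hJ
    rw [hU.isOModel_eU, hI, hcap, hJU] at hJmodel
    have hJI : J ∪ I ∩ U ⊆ I := Set.union_subset (hJ.trans Set.sdiff_subset) Set.inter_subset_left
    have hcapJ : (J ∪ I ∩ U) ∩ U = I ∩ U := by
      rw [Set.union_inter_distrib_right, ← hJU, Set.sdiff_inter_self, Set.empty_union, hcap]
    have heq := hmin _ hJI <| (isOModel_oReduct_iff_oBottom_oTop U).mpr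
      ⟨(isOModel_oBottom_congr hcapJ rfl).mpr hbot, hJmodel⟩
    rw [← heq, Set.union_sdiff_distrib, hJU, Set.sdiff_eq_empty.mpr Set.inter_subset_right,
      Set.union_empty]

theorem isSplittingSet.isStable_of_isSolution {U B T : Set At} {P : Set (ORule At)}
    (hU : isSplittingSet U P) (h : isSolution U P B T) : isStable (B ∪ T) P := by
  obtain ⟨hB, hT⟩ := h
  have hBU : B ∩ U = B := Set.inter_eq_left.mpr hB.subset_of_oBottom
  have hTU : T \ U = T := hU.sdiff_eq_of_isStable_eU hT
  have hcap : (B ∪ T) ∩ U = B ∩ U := by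
    rw [Set.union_inter_distrib_right, ← hTU, Set.sdiff_inter_self, Set.union_empty]
  have hdiff : (B ∪ T) \ U = T := by
    rw [Set.union_sdiff_distrib, hTU, Set.sdiff_eq_empty.mpr hB.subset_of_oBottom, Set.empty_union]
  have htop (J : Set At) : isOModel J (oReduct (eU U P B) T) ↔
      isOModel (J \ U ∪ B) (oReduct (oTop U P) (B ∪ T)) := by
    rw [hU.isOModel_eU, hBU, hTU, Set.union_comm T B]
  refine ⟨(isOModel_oReduct_iff_oBottom_oTop U).mpr
    ⟨(isOModel_oBottom_congr hcap hcap).mpr hB.1, ?_⟩, fun J hJ hJmodel => ?_⟩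
  · have := (htop T).mp hT.1
    rwa [hTU, Set.union_comm T B] at this
  · obtain ⟨hJbot, hJtop⟩ := (isOModel_oReduct_iff_oBottom_oTop U).mp hJmodel
    have hJB : J ∩ U = B := by
      refine hB.2 _ ?_ ((isOModel_oBottom_congr (by simp [Set.inter_assoc]) hcap.symm).mpr hJbot)
      rw [← hBU, ← hcap]
      exact Set.inter_subset_inter_left U hJ
    have hJT : J \ U = T := by
      refine hT.2 _ (hdiff ▸ Set.sdiff_subset_sdiff_left hJ) ((htop _).mpr ?_)
      rwa [Set.sdiff_sdiff, Set.union_self, ← hJB, Set.sdiff_union_inter, hJB]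
    rw [← hJB, ← hJT, Set.inter_union_sdiff]

/-- the splitting theorem.  `I` is a stable model of `P` iff there is a
solution `⟨Ib, It⟩` of `P` w.r.t. the splitting set `U` such that `I = Ib ∪ It`. -/
theorem splitting_theorem (U : Set At) (P : Set (ORule At)) (hU : isSplittingSet U P)
    (I : Set At) :
    isStable I P ↔ ∃ Ib It : Set At, isSolution U P Ib It ∧ I = Ib ∪ It := by
  constructor
  · exact fun h => ⟨I ∩ U, I \ U, hU.isSolution_of_isStable h, (Set.inter_union_sdiff I U).symm⟩
  · rintro ⟨Ib, It, h, rfl⟩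
    exact hU.isStable_of_isSolution h
end

section
/- The splitting theorem still holds for arbitrary splittings: let U be a splitting set of an objective program Π and let ⟨b̂_U(Π), t̂_U(Π)⟩ be any arbitrary splitting of Π with respect to U. Then I ⊆ At is a stable model of Π if and only if I = I_b ∪ I_t for some I_b that is a stable model of b̂_U(Π) and some I_t that is a stable model of ê_U(Π, I_b), where ê_U(Π, I_b) is obtained from t̂_U(Π) by replacing each atom a ∈ U by ⊤ if a ∈ I_b and by ⊥ otherwise. -/
open scoped Classical

variable {At : Type}

namespace OLit

theorem sat_reduct_mono {J K : Set At} (hJK : J ⊆ K) (I : Set At) (L : OLit At)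
    (h : (L.reduct I).sat J) : (L.reduct I).sat K := by
  cases L with
  | pos a => exact hJK h
  | neg a => by_cases ha : a ∈ I <;> simp_all [reduct, sat]
  | nneg a => by_cases ha : a ∈ I <;> simp_all [reduct, sat]
  | _ => exact h

theorem sat_reduct_inter {U : Set At} (J I : Set At) (L : OLit At) (hL : L.atoms ⊆ U) :
    (L.reduct (I ∩ U)).sat (J ∩ U) ↔ (L.reduct I).sat J := by
  cases L with
  | top => rfl
  | bot => rfl
  | _ a => by_cases hI : a ∈ I <;> simp_all [atoms, reduct, sat]

theorem sat_reduct_esimp {U J I : Set At} (hJI : J ∩ U = I ∩ U) (L : OLit At) :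
    ((L.esimp U (I ∩ U)).reduct (I \ U)).sat (J \ U) ↔ (L.reduct I).sat J := by
  have h (a : At) (ha : a ∈ U) : a ∈ J ↔ a ∈ I := by
    have := Set.ext_iff.mp hJI a
    simpa [ha] using this
  cases L with
  | top => rfl
  | bot => rfl
  | _ a =>
    by_cases hU : a ∈ U <;> by_cases hI : a ∈ I <;>
      simp_all [esimp, reduct, sat]

theorem sat_reduct_esimp_sdiff (U K I J : Set At) (L : OLit At) :
    ((L.esimp U K).reduct I).sat (J \ U) ↔ ((L.esimp U K).reduct I).sat J := by
  cases L with
  | top => rfl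
  | bot => rfl
  | _ a =>
    by_cases hU : a ∈ U <;> by_cases hK : a ∈ K <;> by_cases hI : a ∈ I <;>
      simp_all [esimp, reduct, sat]

end OLit

theorem isOModel_oReduct_iff (P : Set (ORule At)) (I J : Set At) :
    isOModel J (oReduct P I) ↔
      ∀ r ∈ P, (∀ L ∈ r.body, (L.reduct I).sat J) → ∃ a ∈ r.head, a ∈ J := by
  simp [isOModel, oReduct, ORule.sat, ORule.reduct]

theorem isOModel_oReduct_simpProg_iff (U K : Set At) (T : Set (ORule At)) (I J : Set At) :
    isOModel J (oReduct (simpProg U K T) I) ↔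
      ∀ r ∈ T, (∀ L ∈ r.body, ((L.esimp U K).reduct I).sat J) → ∃ a ∈ r.head, a ∈ J := by
  simp [isOModel_oReduct_iff, simpProg, ORule.esimp]

theorem isOModel_oReduct_union (B T : Set (ORule At)) (I J : Set At) :
    isOModel J (oReduct (B ∪ T) I) ↔
      isOModel J (oReduct B I) ∧ isOModel J (oReduct T I) := by
  simp only [isOModel_oReduct_iff, Set.mem_union, or_imp, forall_and]

theorem isOModel_oReduct_inter {U : Set At} {B : Set (ORule At)}
    (hB : ∀ r ∈ B, r.atoms ⊆ U) (I J : Set At) :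
    isOModel (J ∩ U) (oReduct B (I ∩ U)) ↔ isOModel J (oReduct B I) := by
  simp only [isOModel_oReduct_iff]
  refine forall₂_congr fun r hr => imp_congr (forall₂_congr fun L hL => ?_) ?_
  · refine OLit.sat_reduct_inter J I L fun a ha => hB r hr (Or.inr ?_)
    exact Set.mem_biUnion (x := L) hL ha
  · refine exists_congr fun a => and_congr_right fun ha => ?_
    exact and_iff_left (hB r hr (Or.inl ha))

theorem ORule.exists_mem_head_sdiff {U : Set At} {r : ORule At}
    (hr : r.headAtoms ∩ U = ∅) (J : Set At) :
    (∃ a ∈ r.head, a ∈ J \ U) ↔ ∃ a ∈ r.head, a ∈ J :=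
  exists_congr fun _ => and_congr_right fun ha =>
    and_iff_left fun hU => (Set.disjoint_iff_inter_eq_empty.mpr hr).notMem_of_mem_left ha hU

theorem isOModel_oReduct_simpProg {U : Set At} {T : Set (ORule At)}
    (hT : ∀ r ∈ T, r.headAtoms ∩ U = ∅) {I J : Set At} (hJI : J ∩ U = I ∩ U) :
    isOModel (J \ U) (oReduct (simpProg U (I ∩ U) T) (I \ U)) ↔
      isOModel J (oReduct T I) := by
  simp only [isOModel_oReduct_iff T, isOModel_oReduct_simpProg_iff]
  exact forall₂_congr fun r hr => imp_congr
    (forall₂_congr fun L _ => OLit.sat_reduct_esimp hJI L)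
    (ORule.exists_mem_head_sdiff (hT r hr) J)

theorem isStable.subset_of_atoms_subset {U : Set At} {B : Set (ORule At)}
    (hB : ∀ r ∈ B, r.atoms ⊆ U) {I : Set At} (hI : isStable I B) : I ⊆ U := by
  have h : isOModel (I ∩ U) (oReduct B I) := by
    rw [← isOModel_oReduct_inter hB, Set.inter_assoc, Set.inter_self,
      isOModel_oReduct_inter hB]
    exact hI.1
  exact Set.inter_eq_left.mp (hI.2 _ Set.inter_subset_left h)

theorem isStable.disjoint_of_simpProg {U K : Set At} {T : Set (ORule At)}
    (hT : ∀ r ∈ T, r.headAtoms ∩ U = ∅) {I : Set At} (hI : isStable I (simpProg U K T)) :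
    Disjoint I U := by
  have h : isOModel (I \ U) (oReduct (simpProg U K T) I) := by
    have hM := hI.1
    rw [isOModel_oReduct_simpProg_iff] at hM ⊢
    intro r hr hbody
    exact (ORule.exists_mem_head_sdiff (hT r hr) I).mpr
      (hM r hr fun L hL => (OLit.sat_reduct_esimp_sdiff U K I I L).mp (hbody L hL))
  exact sdiff_eq_left.mp (hI.2 _ Set.sdiff_subset h)

/-- Shrinking a model of the reduct only on the atoms of `U` preserves the rules whose heads
avoid `U`. -/
theorem isOModel_oReduct_of_sdiff_subset {U : Set At} {T : Set (ORule At)}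
    (hT : ∀ r ∈ T, r.headAtoms ∩ U = ∅) {I J K : Set At} (hK : isOModel K (oReduct T I))
    (hJK : J ⊆ K) (hKJ : K \ U ⊆ J) : isOModel J (oReduct T I) := by
  rw [isOModel_oReduct_iff] at hK ⊢
  intro r hr hbody
  obtain ⟨a, ha, haK⟩ := (ORule.exists_mem_head_sdiff (hT r hr) K).mpr
    (hK r hr fun L hL => OLit.sat_reduct_mono hJK I L (hbody L hL))
  exact ⟨a, ha, hKJ haK⟩

theorem isStable_union_iff {U : Set At} {B T : Set (ORule At)}
    (hB : ∀ r ∈ B, r.atoms ⊆ U) (hT : ∀ r ∈ T, r.headAtoms ∩ U = ∅) (I : Set At) :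
    isStable I (B ∪ T) ↔
      isStable (I ∩ U) B ∧ isStable (I \ U) (simpProg U (I ∩ U) T) := by
  constructor
  · rintro ⟨hM, hmin⟩
    rw [isOModel_oReduct_union] at hM
    refine ⟨⟨(isOModel_oReduct_inter hB I I).mpr hM.1, fun J hJ hJM => ?_⟩,
      (isOModel_oReduct_simpProg hT rfl).mpr hM.2, fun J hJ hJM => ?_⟩
    · have hJU : (J ∪ I \ U) ∩ U = J := by grind
      have hsub : J ∪ I \ U ⊆ I := by grind
      rw [← hmin (J ∪ I \ U) hsub ((isOModel_oReduct_union B T I _).mpr ⟨?_, ?_⟩), hJU]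
      · rwa [← isOModel_oReduct_inter hB, hJU]
      · exact isOModel_oReduct_of_sdiff_subset hT hM.2 hsub Set.subset_union_right
    · have hJU : (I ∩ U ∪ J) \ U = J := by grind
      have hIU : (I ∩ U ∪ J) ∩ U = I ∩ U := by grind
      have hsub : I ∩ U ∪ J ⊆ I := by grind
      have h : I ∩ U ∪ J = I :=
        hmin _ hsub ((isOModel_oReduct_union B T I _).mpr ⟨?_, ?_⟩)
      · rw [← hJU, h]
      · rw [← isOModel_oReduct_inter hB, hIU, isOModel_oReduct_inter hB]
        exact hM.1
      · rwa [← isOModel_oReduct_simpProg hT hIU, hJU]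
  · rintro ⟨⟨hbM, hbmin⟩, htM, htmin⟩
    refine ⟨(isOModel_oReduct_union B T I I).mpr
      ⟨(isOModel_oReduct_inter hB I I).mp hbM, (isOModel_oReduct_simpProg hT rfl).mp htM⟩,
      fun J hJ hJM => ?_⟩
    rw [isOModel_oReduct_union] at hJM
    have hb : J ∩ U = I ∩ U :=
      hbmin _ (Set.inter_subset_inter_left U hJ) ((isOModel_oReduct_inter hB I J).mpr hJM.1)
    have ht : J \ U = I \ U :=
      htmin _ (Set.sdiff_subset_sdiff_left hJ) ((isOModel_oReduct_simpProg hT hb).mpr hJM.2)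
    rw [← Set.inter_union_sdiff J U, hb, ht, Set.inter_union_sdiff]

/-- the splitting theorem for arbitrary splittings. -/
theorem splitting_theorem_arbitrary (U : Set At) (P B T : Set (ORule At))
    (hU : isSplittingSet U P) (hBT : isArbSplitting U P B T) (I : Set At) :
    isStable I P ↔
      ∃ Ib It : Set At, isStable Ib B ∧ isStable It (simpProg U Ib T) ∧ I = Ib ∪ It := by
  obtain ⟨-, rfl, hB, hT⟩ := hBT
  rw [isStable_union_iff hB hT]
  constructor
  · rintro ⟨hb, ht⟩
    exact ⟨_, _, hb, ht, (Set.inter_union_sdiff I U).symm⟩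
  · rintro ⟨Ib, It, hb, ht, rfl⟩
    have hbU := hb.subset_of_atoms_subset hB
    have htU := Set.disjoint_left.mp (ht.disjoint_of_simpProg hT)
    have hinter : (Ib ∪ It) ∩ U = Ib := by grind
    have hdiff : (Ib ∪ It) \ U = It := by grind
    rw [hinter, hdiff]
    exact ⟨hb, ht⟩
end

section
/- For any epistemic program Γ, any set W of propositional interpretations, and any set of atoms U ⊆ At, the subjective reduct satisfies Γ^W = (Γ^{W_b}_U)^{W_t}, where W_b = W|_U and W_t = W|_{At\U}; that is, taking the subjective reduct with respect to W equals first taking the subjective reduct with respect to the projection of W on U restricted to signature U, and then the subjective reduct with respect to the projection on the remaining atoms. -/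
open scoped Classical

variable {At : Type}

theorem OLit.sat_inter {V : Set At} {l : OLit At} (h : l.atoms ⊆ V) (I : Set At) :
    l.sat (I ∩ V) ↔ l.sat I := by
  cases l <;> simp_all [OLit.sat, OLit.atoms]

theorem OLit.atoms_subset_or_subset_compl (l : OLit At) (U : Set At) :
    l.atoms ⊆ U ∨ l.atoms ⊆ Uᶜ := by
  cases l <;> simp [OLit.atoms, em]

theorem SLit.sat_proj {V : Set At} {L : SLit At} (h : L.atoms ⊆ V) (W : Set (Set At)) :
    L.sat (proj W V) ↔ L.sat W := by
  cases L <;> simp [SLit.sat, proj, OLit.sat_inter h]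

theorem SLit.atoms_subset_or_subset_compl (L : SLit At) (U : Set At) :
    L.atoms ⊆ U ∨ L.atoms ⊆ Uᶜ := by
  cases L <;> exact OLit.atoms_subset_or_subset_compl _ U

theorem ELit.fullReduct_sReduct_proj (W : Set (Set At)) (U : Set At) (L : ELit At) :
    (L.sReduct (proj W U) U).fullReduct (proj W Uᶜ) = L.fullReduct W := by
  cases L with
  | obj l => rfl
  | sub L =>
    by_cases hU : L.atoms ⊆ U
    · by_cases hW : L.sat W <;>
        simp [ELit.sReduct, ELit.fullReduct, hU, SLit.sat_proj hU, hW]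
    · have hUc := (L.atoms_subset_or_subset_compl U).resolve_left hU
      simp [ELit.sReduct, ELit.fullReduct, hU, SLit.sat_proj hUc]

theorem ERule.fullReduct_sReduct_proj (W : Set (Set At)) (U : Set At) (r : ERule At) :
    (r.sReduct (proj W U) U).fullReduct (proj W Uᶜ) = r.fullReduct W := by
  simp [ERule.sReduct, ERule.fullReduct, ELit.fullReduct_sReduct_proj]

/-- `Γ^W = (Γ^{W_b}_U)^{W_t}` where `W_b = W|_U` and `W_t = W|_{At∖U}`. -/
theorem sReduct_two_steps (P : Set (ERule At)) (W : Set (Set At)) (U : Set At) :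
    eFullReduct P W = eFullReduct (esReduct P (proj W U) U) (proj W Uᶜ) := by
  simp [eFullReduct, esReduct, Set.image_image, ERule.fullReduct_sReduct_proj]
end

section
/- Let S be any semantics for epistemic programs (an assignment of a collection of S-world views — nonempty sets of propositional interpretations — to each epistemic program) satisfying supra-ASP and the epistemic splitting property, and let Π be a finite, epistemically stratified epistemic program. Then Π has at most one S-world view. -/
open scoped Classical

variable {At : Type}

namespace ERule

/-- The atoms of a rule outside its subjective body literals. -/
def nonSubjAtoms (r : ERule At) : Set At := r.bodyObjAtoms ∪ r.headAtoms

lemma atoms_eq (r : ERule At) : r.atoms = r.nonSubjAtoms ∪ r.bodySubAtoms := by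
  have hL : ∀ L : ELit At, L.atoms = L.objAtoms ∪ L.subAtoms := by
    rintro (l | L) <;> simp [ELit.atoms, ELit.objAtoms, ELit.subAtoms]
  ext a
  simp only [atoms, nonSubjAtoms, bodyObjAtoms, bodySubAtoms, hL, Set.mem_union, Set.mem_iUnion]
  grind

lemma isObjective_sReduct {r : ERule At} {U : Set At} (W : Set (Set At))
    (h : r.bodySubAtoms ⊆ U) : (r.sReduct W U).isObjective := by
  intro L hL
  obtain ⟨L', hL', rfl⟩ := List.mem_map.mp hL
  cases L' with
  | obj l => trivial
  | sub s =>
    have hs : s.atoms ⊆ U := fun a ha => h (Set.mem_biUnion hL' ha)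
    simp only [ELit.sReduct, if_pos hs]
    split <;> trivial

end ERule

lemma SupraASP.subsingleton {S : Semantics At} (hS : SupraASP S) {P : Set (ERule At)}
    (hP : ∀ r ∈ P, r.isObjective) : (S P).Subsingleton := by
  rcases hS P hP with ⟨_, h⟩ | ⟨_, h⟩ <;> simp [h]

/-- If the subjective literals of the top part only mention atoms of the splitting set,
then uniqueness of the world view is inherited from the bottom part. -/
lemma EpistemicSplittingProp.subsingleton {S : Semantics At} (hsplit : EpistemicSplittingProp S)
    (hsupra : SupraASP S) {U : Set At} {P B T : Set (ERule At)} (h : isEpiSplitting U P B T)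
    (hT : ∀ r ∈ T, r.bodySubAtoms ⊆ U) (hB : (S B).Subsingleton) : (S P).Subsingleton := by
  intro W hW W' hW'
  obtain ⟨Wb, hWb, Wt, hWt, rfl⟩ := (hsplit U P B T h W).mp hW
  obtain ⟨Wb', hWb', Wt', hWt', rfl⟩ := (hsplit U P B T h W').mp hW'
  obtain rfl := hB hWb hWb'
  have hobj : ∀ r ∈ esReduct T Wb U, r.isObjective := by
    rintro _ ⟨r, hr, rfl⟩
    exact ERule.isObjective_sReduct Wb (hT r hr)
  rw [hsupra.subsingleton hobj hWt hWt']

/-- Uniqueness for programs of bounded level in which every rule has an atom outside its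
subjective body literals. -/
lemma subsingleton_of_level_lt {S : Semantics At} (hsupra : SupraASP S)
    (hsplit : EpistemicSplittingProp S) (lam : At → ℕ) (n : ℕ) (P : Set (ERule At))
    (hne : ∀ r ∈ P, r.nonSubjAtoms.Nonempty)
    (heq : ∀ r ∈ P, ∀ a ∈ r.nonSubjAtoms, ∀ b ∈ r.nonSubjAtoms, lam a = lam b)
    (hlt : ∀ r ∈ P, ∀ a ∈ r.nonSubjAtoms, ∀ b ∈ r.bodySubAtoms, lam b < lam a)
    (hn : ∀ r ∈ P, ∀ a ∈ r.nonSubjAtoms, lam a < n) : (S P).Subsingleton := by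
  induction n generalizing P with
  | zero =>
    refine hsupra.subsingleton fun r hr => ?_
    obtain ⟨a, ha⟩ := hne r hr
    exact absurd (hn r hr a ha) (Nat.not_lt_zero _)
  | succ n ih =>
    set B : Set (ERule At) := {r ∈ P | ∀ a ∈ r.nonSubjAtoms, lam a < n}
    have hBP : B ⊆ P := fun r hr => hr.1
    refine hsplit.subsingleton hsupra (U := {a | lam a < n}) (B := B) (T := P \ B)
      ⟨Set.inter_sdiff_self _ _, Set.union_sdiff_cancel hBP, ?_, ?_⟩ ?_
      (ih B (fun r hr => hne r (hBP hr)) (fun r hr => heq r (hBP hr))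
        (fun r hr => hlt r (hBP hr)) fun r hr => hr.2)
    · rintro r ⟨hr, hlow⟩ b hb
      rw [ERule.atoms_eq] at hb
      obtain ⟨a, ha⟩ := hne r hr
      exact hb.elim (hlow b) fun hb => (hlt r hr a ha b hb).trans (hlow a ha)
    · rintro r ⟨hr, hrB⟩
      refine Set.eq_empty_of_forall_notMem fun a ⟨ha, haU⟩ => hrB ⟨hr, fun b hb => ?_⟩
      exact heq r hr a ha b hb ▸ haU
    · rintro r ⟨hr, _⟩ b hb
      obtain ⟨a, ha⟩ := hne r hr
      exact (hlt r hr a ha b hb).trans_le (Nat.lt_succ_iff.mp (hn r hr a ha))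

/-- any semantics satisfying supra-ASP and epistemic splitting gives at
most one world view to a finite, epistemically stratified program. -/
theorem stratified_unique_world_view (S : Semantics At)
    (hwv : ∀ (Q : Set (ERule At)) (V : Set (Set At)), V ∈ S Q → V.Nonempty)
    (hsupra : SupraASP S) (hsplit : EpistemicSplittingProp S)
    (P : Set (ERule At)) (hfin : P.Finite) (hstrat : EpistemicallyStratified P)
    (W W' : Set (Set At)) (hW : W ∈ S P) (hW' : W' ∈ S P) :
    W = W' := by
  obtain ⟨lam, heq, hdep⟩ := hstrat
  have hlt : ∀ r ∈ P, ∀ a ∈ r.nonSubjAtoms, ∀ b ∈ r.bodySubAtoms, lam b < lam a :=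
    fun r hr a ha b hb => hdep a b ⟨r, hr, ha.symm, hb⟩
  have hmem : ∀ r ∈ P, ∀ a ∈ r.nonSubjAtoms, a ∈ r.atoms \ r.bodySubAtoms := fun r hr a ha =>
    ⟨r.atoms_eq ▸ Or.inl ha, fun h => (hlt r hr a ha a h).false⟩
  have heq' : ∀ r ∈ P, ∀ a ∈ r.nonSubjAtoms, ∀ b ∈ r.nonSubjAtoms, lam a = lam b :=
    fun r hr a ha b hb => heq r hr a (hmem r hr a ha) b (hmem r hr b hb)
  have hfinLevels : (⋃ r ∈ P, lam '' r.nonSubjAtoms).Finite := by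
    refine hfin.biUnion fun r hr => Set.Subsingleton.finite ?_
    rintro _ ⟨a, ha, rfl⟩ _ ⟨b, hb, rfl⟩
    exact heq' r hr a ha b hb
  obtain ⟨n, hn⟩ := hfinLevels.bddAbove
  set B : Set (ERule At) := {r ∈ P | r.nonSubjAtoms.Nonempty}
  have hBP : B ⊆ P := fun r hr => hr.1
  have hB : (S B).Subsingleton :=
    subsingleton_of_level_lt hsupra hsplit lam (n + 1) B (fun r hr => hr.2)
      (fun r hr => heq' r (hBP hr)) (fun r hr => hlt r (hBP hr)) fun r hr a ha =>
        Nat.lt_succ_of_le (hn (Set.mem_biUnion (hBP hr) (Set.mem_image_of_mem lam ha)))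
  refine hsplit.subsingleton hsupra (U := Set.univ) (B := B) (T := P \ B)
    ⟨Set.inter_sdiff_self _ _, Set.union_sdiff_cancel hBP, fun r _ => Set.subset_univ _, ?_⟩
    (fun r _ => Set.subset_univ _) hB hW hW'
  rintro r ⟨hr, hrB⟩
  rw [Set.inter_univ]
  exact Set.not_nonempty_iff_eq_empty.mp fun h => hrB ⟨hr, h⟩
end
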